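/- For every $k\in\mathbb{Z}_{\geq 0}$, the map $M_{\overline{z}^k}:(\mathcal{E}_k)_{\mathrm{hw}}\to(\mathcal{E}_0)_{\mathrm{hw}}$, $e\mapsto\overline{z}^k e$, sending highest weight elements of $\mathcal{E}_k$ to highest weight elements of $\mathcal{E}_0=\mathcal{O}_q(G/L_S)$, is well defined and injective; consequently, since $\mathcal{E}_0$ is multiplicity free as a $U_q(\mathfrak{g})$-module, $\mathcal{E}_k$ is multiplicity free. -/

import Mathlib

noncomputable section

/-!
Multiplication by `z̄^k` on highest weight elements, as in [STATEMENT 11]: for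
every `k ∈ ℤ_{≥0}`, the map `M_{z̄^k} : (E_k)_{hw} → (E_0)_{hw}`, `e ↦ z̄^k e`,
is well defined and injective; consequently, since `E_0 = O_q(G/L_S)` is
multiplicity free as a `U_q(g)`-module, so is `E_k`. -/

/-- Data of an irreducible quantum flag manifold `O_q(G/L_S)` with the line
modules `E_k ⊆ O_q(G)` and the highest-weight machinery of the right
`U_q(g)`-action on `O_q(G)`. -/
structure QuantumFlagHW (A : Type) [Ring A] [Algebra ℂ A]
    (U : Type) [Ring U]
    (P : Type) [AddCommGroup P]
    (ι : Type) where
  /-- the right action `a ◁ u` of `U_q(g)` on `O_q(G)` -/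
  ract : A → U → A
  ract_add : ∀ a b u, ract (a + b) u = ract a u + ract b u
  ract_addU : ∀ a u v, ract a (u + v) = ract a u + ract a v
  ract_smul : ∀ (c : ℂ) a u, ract (c • a) u = c • ract a u
  ract_mulU : ∀ a u v, ract a (u * v) = ract (ract a u) v
  ract_oneU : ∀ a, ract a 1 = a
  /-- the generators `E_i` of `U_q(g)` -/
  Egen : ι → U
  /-- the weight space of weight `λ` in `O_q(G)` -/
  wtsp : P → Submodule ℂ A
  /-- the fundamental weight `ϖx` of the crossed node `α_x`, `Π \ S = {α_x}` -/
  ϖx : P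
  /-- the action of the longest element `w0` of the Weyl group on weights -/
  w0 : P →+ P
  /-- the relative line modules `E_k ⊆ O_q(G)`, with `E 0 = O_q(G/L_S)` -/
  E : ℤ → Submodule ℂ A
  E_ract : ∀ k, ∀ a ∈ E k, ∀ u, ract a u ∈ E k
  E_mul : ∀ k l, ∀ a ∈ E k, ∀ b ∈ E l, a * b ∈ E (k + l)
  /-- the highest-weight generator `z` among the `z_i`, of weight `ϖx` -/
  z : A
  z_mem : z ∈ E 1
  z_ne : z ≠ 0
  z_wt : z ∈ wtsp ϖx
  z_hw : ∀ i, ract z (Egen i) = 0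
  /-- the highest-weight generator `z̄` among the `z̄_j`, of weight `-w0(ϖx)` -/
  zbar : A
  zbar_mem : zbar ∈ E (-1)
  zbar_ne : zbar ≠ 0
  zbar_wt : zbar ∈ wtsp (-(w0 ϖx))
  zbar_hw : ∀ i, ract zbar (Egen i) = 0
  /-- the product of two highest weight elements of `O_q(G)` (weight vectors
  killed by all `E_i`) is again a highest weight element, of the sum of the
  weights -/
  hw_mul_wt : ∀ a b lam mu, a ∈ wtsp lam → b ∈ wtsp mu → a * b ∈ wtsp (lam + mu)
  hw_mul_hw : ∀ a b, (∀ i, ract a (Egen i) = 0) → (∀ i, ract b (Egen i) = 0) →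
    ∀ i, ract (a * b) (Egen i) = 0

namespace QuantumFlagHW

variable {A : Type} [Ring A] [Algebra ℂ A] {U : Type} [Ring U]
  {P : Type} [AddCommGroup P] {ι : Type}

variable (S : QuantumFlagHW A U P ι)

/-- `a` is a highest weight element of `M ⊆ O_q(G)` of weight `lam`: a nonzero
weight vector of weight `lam` in `M` annihilated by all the `E_i`. -/
def IsHWOfWeight (M : Submodule ℂ A) (lam : P) (a : A) : Prop :=
  a ∈ M ∧ a ≠ 0 ∧ a ∈ S.wtsp lam ∧ ∀ i, S.ract a (S.Egen i) = 0

/-- `a` is a highest weight element of `M`. -/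
def IsHWElement (M : Submodule ℂ A) (a : A) : Prop :=
  ∃ lam : P, S.IsHWOfWeight M lam a

/-- The set of highest weights of the `U_q(g)`-module `M`. -/
def HighestWeights (M : Submodule ℂ A) : Set P :=
  {lam | ∃ a, S.IsHWOfWeight M lam a}

/-- `M` is multiplicity free as a `U_q(g)`-module: any two highest weight
elements of the same weight are proportional. -/
def MultiplicityFree (M : Submodule ℂ A) : Prop :=
  ∀ lam : P, ∀ a b : A, S.IsHWOfWeight M lam a → S.IsHWOfWeight M lam b →
    ∃ c : ℂ, a = c • b

/-- Left multiplication by `z̄^k` maps highest weight elements of `E_l` to highest weight elements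
of `E_{l-k}`, shifting the weight by `k` times the weight of `z̄`. -/
theorem IsHWOfWeight.zbar_pow_mul [NoZeroDivisors A] {S : QuantumFlagHW A U P ι} {l : ℤ} {lam : P}
    {a : A} (ha : S.IsHWOfWeight (S.E l) lam a) (k : ℕ) :
    S.IsHWOfWeight (S.E (l - k)) (k • -(S.w0 S.ϖx) + lam) (S.zbar ^ k * a) := by
  induction k with
  | zero => simpa using ha
  | succ k ih =>
    obtain ⟨hmem, hne, hwt, hhw⟩ := ih
    rw [pow_succ', mul_assoc, succ_nsmul', add_assoc,
      show l - ((k + 1 : ℕ) : ℤ) = -1 + (l - k) by push_cast; ring]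
    exact ⟨S.E_mul _ _ _ S.zbar_mem _ hmem, mul_ne_zero S.zbar_ne hne,
      S.hw_mul_wt _ _ _ _ S.zbar_wt hwt, S.hw_mul_hw _ _ S.zbar_hw hhw⟩

/-- Left multiplication by `z̄^k` is injective. -/
theorem zbar_pow_mul_injective [NoZeroDivisors A] (k : ℕ) :
    Function.Injective fun a : A => S.zbar ^ k * a := by
  have : Nontrivial A := ⟨⟨_, _, S.zbar_ne⟩⟩
  have : IsDomain A := NoZeroDivisors.to_isDomain A
  exact mul_right_injective₀ (pow_ne_zero k S.zbar_ne)

/-- **Multiplication by `z̄^k` on highest weight elements**: the map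
`e ↦ z̄^k e` sends highest weight elements of `E_k` to highest weight elements
of `E_0`, is injective on them, and multiplicity freeness of `E_0` implies that
of `E_k`. -/
theorem mul_zbar_pow_hw [NoZeroDivisors A]
    (hmf : S.MultiplicityFree (S.E 0)) (k : ℕ) :
    (∀ a : A, S.IsHWElement (S.E (k : ℤ)) a →
        S.IsHWElement (S.E 0) (S.zbar ^ k * a)) ∧
    Set.InjOn (fun a : A => S.zbar ^ k * a)
      {a : A | S.IsHWElement (S.E (k : ℤ)) a} ∧
    S.MultiplicityFree (S.E (k : ℤ)) := by
  have key : ∀ {lam : P} {a : A}, S.IsHWOfWeight (S.E (k : ℤ)) lam a →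
      S.IsHWOfWeight (S.E 0) (k • -(S.w0 S.ϖx) + lam) (S.zbar ^ k * a) := fun ha => by
    simpa only [sub_self] using ha.zbar_pow_mul k
  refine ⟨fun a ⟨lam, ha⟩ => ⟨_, key ha⟩, (S.zbar_pow_mul_injective k).injOn,
    fun lam a b ha hb => ?_⟩
  obtain ⟨c, hc⟩ := hmf _ _ _ (key ha) (key hb)
  exact ⟨c, S.zbar_pow_mul_injective k (by simpa only [mul_smul_comm] using hc)⟩

end QuantumFlagHW

end
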